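/- Let A ∈ GL_n(ℚ) and let L ≤ ℤ^n ∩ A⁻¹(ℤ^n) be a finite-index subgroup with L ≠ ℤ^n and AL ≠ ℤ^n, and let H = ⟨x_1,…,x_n⟩ be the base subgroup of G := G(A,L). If M is a subgroup of G with H ⊆ M and M ⊆ kHk⁻¹ for some k ∈ G, then M = H. -/

import Mathlib

open Matrix

noncomputable section

/-- The coercion `ℤ^n → ℚ^n` as an additive homomorphism. -/
def ZtoQ (n : ℕ) : (Fin n → ℤ) →+ (Fin n → ℚ) :=
  AddMonoidHom.mk' (fun v i => (v i : ℚ)) (by intro a b; funext i; simp)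

/-- The image `A·L ⊆ ℚ^n` of a subgroup `L ≤ ℤ^n` under the matrix `A`. -/
def QImage {n : ℕ} (A : Matrix (Fin n) (Fin n) ℚ) (L : AddSubgroup (Fin n → ℤ)) :
    AddSubgroup (Fin n → ℚ) :=
  (L.map (ZtoQ n)).map A.mulVecLin.toAddMonoidHom

/-- The subgroup `AL` of `ℤ^n`, i.e. the set of integer vectors lying in `A·L`. -/
def ALsub {n : ℕ} (A : Matrix (Fin n) (Fin n) ℚ) (L : AddSubgroup (Fin n → ℤ)) :
    AddSubgroup (Fin n → ℤ) :=
  (QImage A L).comap (ZtoQ n)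

/-- `x^v = x_1^{v_1} ⋯ x_n^{v_n}` in the free group on `x_1,…,x_n,t`. -/
def xWord (n : ℕ) (v : Fin n → ℤ) : FreeGroup (Fin n ⊕ Unit) :=
  (List.ofFn fun i => (FreeGroup.of (Sum.inl i) : FreeGroup (Fin n ⊕ Unit)) ^ (v i)).prod

/-- The relations of the Leary–Minasyan group `G(A,L)`. -/
def LMrels (n : ℕ) (A : Matrix (Fin n) (Fin n) ℚ) (L : AddSubgroup (Fin n → ℤ)) :
    Set (FreeGroup (Fin n ⊕ Unit)) :=
  {r | (∃ i j : Fin n,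
          r = FreeGroup.of (Sum.inl i) * FreeGroup.of (Sum.inl j) *
              (FreeGroup.of (Sum.inl i))⁻¹ * (FreeGroup.of (Sum.inl j))⁻¹) ∨
       (∃ v ∈ L, ∃ w : Fin n → ℤ, ZtoQ n w = A.mulVec (ZtoQ n v) ∧
          r = FreeGroup.of (Sum.inr ()) * xWord n v * (FreeGroup.of (Sum.inr ()))⁻¹ *
              (xWord n w)⁻¹)}

/-- The Leary–Minasyan group `G(A,L)`. -/
abbrev LM (n : ℕ) (A : Matrix (Fin n) (Fin n) ℚ) (L : AddSubgroup (Fin n → ℤ)) :=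
  PresentedGroup (LMrels n A L)

/-- The generator `x_i` of `G(A,L)`. -/
def Xg (n : ℕ) (A : Matrix (Fin n) (Fin n) ℚ) (L : AddSubgroup (Fin n → ℤ)) (i : Fin n) :
    LM n A L :=
  PresentedGroup.of (Sum.inl i)

/-- The stable letter `t` of `G(A,L)`. -/
def Tg (n : ℕ) (A : Matrix (Fin n) (Fin n) ℚ) (L : AddSubgroup (Fin n → ℤ)) : LM n A L :=
  PresentedGroup.of (Sum.inr ())

/-- The element `x^v` of `G(A,L)`. -/
def Xv (n : ℕ) (A : Matrix (Fin n) (Fin n) ℚ) (L : AddSubgroup (Fin n → ℤ)) (v : Fin n → ℤ) :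
    LM n A L :=
  (List.ofFn fun i => (Xg n A L i) ^ (v i)).prod

/-- The base subgroup `H = ⟨x_1,…,x_n⟩` of `G(A,L)`. -/
def Hsub (n : ℕ) (A : Matrix (Fin n) (Fin n) ℚ) (L : AddSubgroup (Fin n → ℤ)) :
    Subgroup (LM n A L) :=
  Subgroup.closure (Set.range (Xg n A L))

/-- The set `⋃_{j∈ℤ} A^j(ℤ^n) ⊆ ℚ^n`. -/
def unionSet {n : ℕ} (A : Matrix (Fin n) (Fin n) ℚ) : Set (Fin n → ℚ) :=
  ⋃ j : ℤ, (A ^ j).mulVec '' Set.range (ZtoQ n)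

/-- Cast an integer matrix to a rational matrix. -/
def QMat {k : ℕ} (M : Matrix (Fin k) (Fin k) ℤ) : Matrix (Fin k) (Fin k) ℚ :=
  M.map (Int.cast)

/-- The block matrix `[[1, 0ᵀ],[u, C]]`. -/
def blockOne {k : ℕ} (u : Fin k → ℤ) (C : Matrix (Fin k) (Fin k) ℤ) :
    Matrix (Fin (k+1)) (Fin (k+1)) ℤ :=
  Matrix.of fun i j =>
    Fin.cases (Fin.cases 1 (fun _ => 0) j) (fun i' => Fin.cases (u i') (fun j' => C i' j') j) i

/-- Transport a subgroup of `ℤ^a` along an equality `a = b` of dimensions. -/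
def reindexSub {a b : ℕ} (h : a = b) (L : AddSubgroup (Fin a → ℤ)) :
    AddSubgroup (Fin b → ℤ) :=
  L.map (AddMonoidHom.mk' (fun v => v ∘ (finCongr h).symm) (fun _ _ => rfl))

namespace HNNExtension

open NormalWord

variable {G : Type*} [Group G] {A B : Subgroup G} (φ : A ≃* B)

/-- Every element of an HNN extension is the product of a reduced word. -/
theorem exists_reducedWord_prod_eq (k : HNNExtension G A B φ) :
    ∃ w : ReducedWord G A B, w.prod φ = k := by
  obtain ⟨d⟩ := TransversalPair.nonempty G A B
  exact ⟨(k • (NormalWord.empty : NormalWord d)).toReducedWord, by simp [prod_smul]⟩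

/-- Right multiplication by a base group element only changes the last base letter of a reduced
word which is not in the base group. -/
theorem NormalWord.ReducedWord.exists_prod_eq_mul_of (w : ReducedWord G A B) (hw : w.toList ≠ []) (g : G) :
    ∃ w' : ReducedWord G A B, w'.head = w.head ∧ w'.prod φ = w.prod φ * of g := by
  obtain ⟨h, l, hl⟩ := w
  obtain ⟨l₀, ⟨u, a⟩, rfl⟩ := List.eq_nil_or_concat' l |>.resolve_left hw
  refine ⟨⟨h, l₀ ++ [(u, a * g)], ?_⟩, rfl, ?_⟩
  · rw [List.isChain_append] at hl ⊢
    simpa using hl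
  · simp [ReducedWord.prod, mul_assoc]

/-- If both associated subgroups are proper, an element conjugating the base group into itself
lies in the base group. -/
theorem mem_range_of_of_forall_conj_mem (hA : A ≠ ⊤) (hB : B ≠ ⊤) (k : HNNExtension G A B φ)
    (hk : ∀ g : G, k⁻¹ * of g * k ∈ (of : G →* HNNExtension G A B φ).range) :
    k ∈ (of : G →* HNNExtension G A B φ).range := by
  obtain ⟨w, rfl⟩ := exists_reducedWord_prod_eq φ k
  by_cases hw : w.toList = []
  · exact ⟨w.head, by simp [ReducedWord.prod, hw]⟩
  exfalso
  obtain ⟨p, l, hl⟩ := List.exists_cons_of_ne_nil hw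
  have key : ∀ g : G, g ∈ toSubgroup A B (-p.1) := by
    intro g
    obtain ⟨g', hg'⟩ := hk (w.head * g * w.head⁻¹)
    obtain ⟨w', hw', hprod⟩ := ReducedWord.exists_prod_eq_mul_of φ w hw g'
    have h := (ReducedWord.map_fst_eq_and_of_prod_eq φ (w₂ := w')
      (w₁ := ⟨w.head * g, w.toList, w.chain⟩) (by
        rw [hprod, hg']
        simp [ReducedWord.prod, mul_assoc])).2 p.1 (by simp [hl])
    simpa [hw'] using h
  rcases Int.units_eq_one_or p.1 with h | h
  · exact hB (eq_top_iff.2 fun g _ => by simpa [h] using key g)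
  · exact hA (eq_top_iff.2 fun g _ => by simpa [h] using key g)

end HNNExtension

theorem List.prod_ofFn_mul_of_commute {G : Type*} [Monoid G] {n : ℕ} (f g : Fin n → G)
    (h : ∀ i j, Commute (f i) (g j)) :
    (List.ofFn fun i => f i * g i).prod = (List.ofFn f).prod * (List.ofFn g).prod := by
  induction n with
  | zero => simp
  | succ n ih =>
    have hc : Commute (List.ofFn fun i : Fin n => f i.succ).prod (g 0) :=
      Commute.list_prod_left _ _ fun x hx => by
        obtain ⟨i, rfl⟩ := (List.mem_ofFn' _ _).1 hx
        exact h _ _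
    simp only [List.ofFn_succ, List.prod_cons, ih _ _ fun i j => h i.succ j.succ]
    exact hc.symm.mul_mul_mul_comm _ _

/-- The homomorphism `v ↦ y₁ ^ v₁ ⋯ yₙ ^ vₙ` defined by a commuting family `y`. -/
def zpowProdHom {G : Type*} [Group G] {n : ℕ} (y : Fin n → G) (h : ∀ i j, Commute (y i) (y j)) :
    Multiplicative (Fin n → ℤ) →* G :=
  MonoidHom.mk' (fun v => (List.ofFn fun i => y i ^ v.toAdd i).prod) fun v w => by
    simp only [toAdd_mul, Pi.add_apply, _root_.zpow_add]
    exact List.prod_ofFn_mul_of_commute _ _ fun i j => (h i j).zpow_zpow _ _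

theorem zpowProdHom_single {G : Type*} [Group G] {n : ℕ} (y : Fin n → G)
    (h : ∀ i j, Commute (y i) (y j)) (i : Fin n) :
    zpowProdHom y h (Multiplicative.ofAdd (Pi.single i 1)) = y i := by
  change (List.ofFn fun j => y j ^ (Pi.single i 1 : Fin n → ℤ) j).prod = y i
  induction n with
  | zero => exact i.elim0
  | succ n ih =>
    rw [List.ofFn_succ, List.prod_cons]
    induction i using Fin.cases with
    | zero => simp [List.ofFn_const]
    | succ i =>
      simpa [Pi.single_apply] using ih (fun j => y j.succ) (fun a b => h _ _) i

theorem ofAdd_eq_prod_ofFn {n : ℕ} (v : Fin n → ℤ) :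
    Multiplicative.ofAdd v =
      (List.ofFn fun i => Multiplicative.ofAdd (Pi.single i 1 : Fin n → ℤ) ^ v i).prod := by
  rw [List.prod_ofFn]
  simp only [← ofAdd_zsmul, ← ofAdd_sum]
  congr 1
  ext j
  simp [Finset.sum_apply, Pi.single_apply]

theorem ZtoQ_injective (n : ℕ) : Function.Injective (ZtoQ n) := fun v w h =>
  funext fun i => Int.cast_injective (congrFun h i : ((v i : ℤ) : ℚ) = w i)

theorem mem_ALsub {n : ℕ} {A : Matrix (Fin n) (Fin n) ℚ} {L : AddSubgroup (Fin n → ℤ)}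
    {w : Fin n → ℤ} : w ∈ ALsub A L ↔ ∃ v ∈ L, ZtoQ n w = A.mulVec (ZtoQ n v) := by
  simp [ALsub, QImage, eq_comm]

/-- The isomorphism `L ≃ AL` induced by `A`, written multiplicatively. -/
theorem exists_mulEquiv_ALsub {n : ℕ} {A : Matrix (Fin n) (Fin n) ℚ} (hA : IsUnit A.det)
    {L : AddSubgroup (Fin n → ℤ)} (hLA : QImage A L ≤ (ZtoQ n).range) :
    ∃ φ : L.toSubgroup ≃* (ALsub A L).toSubgroup, ∀ v : L.toSubgroup,
      ZtoQ n (φ v).1.toAdd = A.mulVec (ZtoQ n v.1.toAdd) := by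
  have hinj : Function.Injective A.mulVec :=
    Matrix.mulVec_injective_of_isUnit ((Matrix.isUnit_iff_isUnit_det A).2 hA)
  have hex : ∀ v : L.toSubgroup, ∃ w : (ALsub A L).toSubgroup,
      ZtoQ n w.1.toAdd = A.mulVec (ZtoQ n v.1.toAdd) := by
    intro v
    obtain ⟨w, hw⟩ := hLA ⟨_, ⟨v.1.toAdd, v.2, rfl⟩, rfl⟩
    exact ⟨⟨Multiplicative.ofAdd w, mem_ALsub.2 ⟨v.1.toAdd, v.2, hw⟩⟩, hw⟩
  choose f hf using hex
  refine ⟨MulEquiv.ofBijective (MonoidHom.mk' f fun v w => ?_) ⟨fun v w h => ?_, fun w => ?_⟩, hf⟩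
  · apply Subtype.ext
    apply Multiplicative.toAdd.injective
    apply ZtoQ_injective
    simp [hf, Matrix.mulVec_add]
  · have h' : f v = f w := h
    apply Subtype.ext
    apply Multiplicative.toAdd.injective
    apply ZtoQ_injective
    apply hinj
    rw [← hf, ← hf, h']
  · obtain ⟨v, hv, hw⟩ := mem_ALsub.1 w.2
    refine ⟨⟨Multiplicative.ofAdd v, hv⟩, ?_⟩
    apply Subtype.ext
    apply Multiplicative.toAdd.injective
    apply ZtoQ_injective
    exact (hf _).trans hw.symm

section LearyMinasyan

variable {n : ℕ} {A : Matrix (Fin n) (Fin n) ℚ} {L : AddSubgroup (Fin n → ℤ)}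

theorem commute_Xg (i j : Fin n) : Commute (Xg n A L i) (Xg n A L j) := by
  have h : PresentedGroup.mk (LMrels n A L) _ = 1 :=
    PresentedGroup.one_of_mem (Or.inl ⟨i, j, rfl⟩)
  simp only [map_mul, map_inv] at h
  exact mul_inv_eq_iff_eq_mul.1 (mul_inv_eq_one.1 h)

theorem mk_xWord (v : Fin n → ℤ) :
    PresentedGroup.mk (LMrels n A L) (xWord n v) = Xv n A L v := by
  simp only [xWord, Xv, map_list_prod, List.map_ofFn]
  congr 2

theorem Tg_mul_Xv {v w : Fin n → ℤ} (hv : v ∈ L) (hw : ZtoQ n w = A.mulVec (ZtoQ n v)) :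
    Tg n A L * Xv n A L v = Xv n A L w * Tg n A L := by
  have h : PresentedGroup.mk (LMrels n A L) _ = 1 :=
    PresentedGroup.one_of_mem (Or.inr ⟨v, hv, w, hw, rfl⟩)
  simp only [map_mul, map_inv, mk_xWord] at h
  exact mul_inv_eq_iff_eq_mul.1 (mul_inv_eq_one.1 h)

theorem Xv_mem_Hsub (v : Fin n → ℤ) : Xv n A L v ∈ Hsub n A L :=
  Subgroup.list_prod_mem _ fun x hx => by
    obtain ⟨i, rfl⟩ := (List.mem_ofFn' _ _).1 hx
    exact zpow_mem (Subgroup.subset_closure (Set.mem_range_self i)) _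

variable (φ : L.toSubgroup ≃* (ALsub A L).toSubgroup)
  (hφ : ∀ v : L.toSubgroup, ZtoQ n (φ v).1.toAdd = A.mulVec (ZtoQ n v.1.toAdd))

/-- The homomorphism from the HNN extension to the presented group. -/
def LMofHNN : HNNExtension (Multiplicative (Fin n → ℤ)) L.toSubgroup (ALsub A L).toSubgroup φ →*
    LM n A L :=
  HNNExtension.lift (zpowProdHom (Xg n A L) commute_Xg) (Tg n A L)
    fun v => Tg_mul_Xv v.2 (hφ v)

theorem LMofHNN_of (v : Multiplicative (Fin n → ℤ)) :
    LMofHNN φ hφ (HNNExtension.of v) = Xv n A L v.toAdd :=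
  HNNExtension.lift_of _ _ _ _

theorem LMofHNN_t : LMofHNN φ hφ HNNExtension.t = Tg n A L :=
  HNNExtension.lift_t _ _ _

theorem lift_xWord {G : Type*} [Group G] (f : Multiplicative (Fin n → ℤ) →* G) (s : G)
    (v : Fin n → ℤ) :
    FreeGroup.lift (Sum.elim (fun i => f (Multiplicative.ofAdd (Pi.single i 1))) fun _ => s)
      (xWord n v) = f (Multiplicative.ofAdd v) := by
  rw [ofAdd_eq_prod_ofFn v]
  simp only [xWord, map_list_prod, List.map_ofFn]
  congr 2
  ext i
  simp

/-- The homomorphism from the presented group to the HNN extension. -/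
def LMtoHNN : LM n A L →*
    HNNExtension (Multiplicative (Fin n → ℤ)) L.toSubgroup (ALsub A L).toSubgroup φ :=
  PresentedGroup.toGroup
    (f := Sum.elim (fun i => HNNExtension.of (Multiplicative.ofAdd (Pi.single i 1)))
      fun _ => HNNExtension.t) <| by
    rintro r (⟨i, j, rfl⟩ | ⟨v, hv, w, hw, rfl⟩)
    · simp only [map_mul, map_inv, FreeGroup.lift_apply_of, Sum.elim_inl]
      rw [((Commute.all _ _).map HNNExtension.of).eq, mul_inv_cancel_right, mul_inv_cancel]
    · have hw' : (φ ⟨Multiplicative.ofAdd v, hv⟩ : Multiplicative (Fin n → ℤ)) =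
          Multiplicative.ofAdd w := by
        apply Multiplicative.toAdd.injective
        apply ZtoQ_injective
        rw [hφ]
        exact hw.symm
      have ht := HNNExtension.equiv_eq_conj (φ := φ) ⟨Multiplicative.ofAdd v, hv⟩
      simp only [map_mul, map_inv, lift_xWord, FreeGroup.lift_apply_of, Sum.elim_inr]
      rw [← hw', ht, mul_inv_cancel]

theorem LMtoHNN_Xg (i : Fin n) : LMtoHNN φ hφ (Xg n A L i) =
    HNNExtension.of (Multiplicative.ofAdd (Pi.single i 1)) :=
  PresentedGroup.toGroup.of _

theorem LMtoHNN_Tg : LMtoHNN φ hφ (Tg n A L) = HNNExtension.t :=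
  PresentedGroup.toGroup.of _

theorem LMtoHNN_Xv (v : Fin n → ℤ) : LMtoHNN φ hφ (Xv n A L v) =
    HNNExtension.of (Multiplicative.ofAdd v) := by
  rw [← mk_xWord]
  exact lift_xWord _ _ v

theorem LMofHNN_LMtoHNN (g : LM n A L) : LMofHNN φ hφ (LMtoHNN φ hφ g) = g := by
  suffices h : (LMofHNN φ hφ).comp (LMtoHNN φ hφ) = MonoidHom.id _ from DFunLike.congr_fun h g
  apply PresentedGroup.ext
  rintro (i | _)
  · change LMofHNN φ hφ (LMtoHNN φ hφ (Xg n A L i)) = Xg n A L i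
    rw [LMtoHNN_Xg, LMofHNN_of]
    exact zpowProdHom_single _ commute_Xg i
  · change LMofHNN φ hφ (LMtoHNN φ hφ (Tg n A L)) = Tg n A L
    rw [LMtoHNN_Tg, LMofHNN_t]

theorem LMtoHNN_mem_range_of_iff (g : LM n A L) :
    LMtoHNN φ hφ g ∈ (HNNExtension.of : Multiplicative (Fin n → ℤ) →*
      HNNExtension _ L.toSubgroup (ALsub A L).toSubgroup φ).range ↔ g ∈ Hsub n A L := by
  constructor
  · rintro ⟨v, hv⟩
    rw [← LMofHNN_LMtoHNN φ hφ g, ← hv, LMofHNN_of]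
    exact Xv_mem_Hsub v.toAdd
  · intro hg
    refine (Subgroup.closure_le (Subgroup.comap (LMtoHNN φ hφ) HNNExtension.of.range)).2 ?_ hg
    rintro _ ⟨i, rfl⟩
    exact ⟨_, (LMtoHNN_Xg φ hφ i).symm⟩

end LearyMinasyan

/-- **Lemma (maximality of the base subgroup).** Suppose `L ≠ ℤ^n` and `AL ≠ ℤ^n`.
If `M` is a subgroup of `G(A,L)` with `H ⊆ M` and `M ⊆ kHk⁻¹` for some `k`, then `M = H`. -/
theorem LM_base_subgroup_maximal
    (n : ℕ) (A : Matrix (Fin n) (Fin n) ℚ) (hA : IsUnit A.det)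
    (L : AddSubgroup (Fin n → ℤ)) (hL : L.FiniteIndex)
    (hLA : QImage A L ≤ (ZtoQ n).range)
    (hneL : L ≠ ⊤) (hneAL : ALsub A L ≠ ⊤)
    (M : Subgroup (LM n A L)) (k : LM n A L)
    (hHM : Hsub n A L ≤ M)
    (hMk : M ≤ (Hsub n A L).map (MulAut.conj k).toMonoidHom) :
    M = Hsub n A L := by
  obtain ⟨φ, hφ⟩ := exists_mulEquiv_ALsub hA hLA
  have hconj : ∀ g ∈ M, k⁻¹ * g * k ∈ Hsub n A L := by
    intro g hg
    obtain ⟨h, hh, rfl⟩ := hMk hg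
    simpa [mul_assoc] using hh
  have hk : k ∈ Hsub n A L := by
    rw [← LMtoHNN_mem_range_of_iff φ hφ]
    refine HNNExtension.mem_range_of_of_forall_conj_mem φ (by simpa using hneL)
      (by simpa using hneAL) _ fun g => ?_
    rw [← ofAdd_toAdd g, ← LMtoHNN_Xv φ hφ, ← map_inv, ← map_mul, ← map_mul,
      LMtoHNN_mem_range_of_iff]
    exact hconj _ (hHM (Xv_mem_Hsub _))
  refine le_antisymm (fun g hg => ?_) hHM
  have h := mul_mem (mul_mem hk (hconj g hg)) (inv_mem hk)
  simpa [mul_assoc] using h
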